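/- Let K and H be complex Hilbert spaces and X = [[X₁₁, X₁₂], [X₁₂*, X₂₂]] a selfadjoint contraction on K ⊕ H. Assume: (1) ran(I + X)^{1/2} ∩ ({0} ⊕ H) = {0} and ran(I − X)^{1/2} ∩ ({0} ⊕ H) = {0} (equivalently, the Kreĭn shorted operators (I + X)_H and (I − X)_H are both zero), and (2) ‖X₂₂‖ < 1. Define the selfadjoint contractions Ẑ₀ = X₁₁ − X₁₂ (I + X₂₂)^{-1} X₁₂* and Ẑ₁ = X₁₁ + X₁₂ (I − X₂₂)^{-1} X₁₂* on K. Then ran(Ẑ₁ − Ẑ₀)^{1/2} ∩ ran(I + Ẑ₀)^{1/2} = {0} and ran(Ẑ₁ − Ẑ₀)^{1/2} ∩ ran(I − Ẑ₁)^{1/2} = {0}. -/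

import Mathlib

open ContinuousLinearMap Complex Filter
open scoped InnerProductSpace Topology

set_option synthInstance.maxHeartbeats 1000000
set_option maxHeartbeats 1000000

noncomputable section

variable {E F : Type*} [NormedAddCommGroup E] [InnerProductSpace ℂ E]
  [NormedAddCommGroup F] [InnerProductSpace ℂ F]

/-- The 2×2 block operator `[[A, B], [C, D]]` on the Hilbert space orthogonal direct sum
`E ⊕ F` (realized as `WithLp 2 (E × F)`), acting by `(e, f) ↦ (A e + B f, C e + D f)`. -/
def blk (A : E →L[ℂ] E) (B : F →L[ℂ] E) (C : E →L[ℂ] F) (D : F →L[ℂ] F) :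
    WithLp 2 (E × F) →L[ℂ] WithLp 2 (E × F) :=
  ((WithLp.prodContinuousLinearEquiv 2 ℂ E F).symm : E × F →L[ℂ] WithLp 2 (E × F)) ∘L
    ((A.coprod B).prod (C.coprod D)) ∘L
    ((WithLp.prodContinuousLinearEquiv 2 ℂ E F) : WithLp 2 (E × F) →L[ℂ] E × F)

/-- The isometric embedding of the first summand `E` into `E ⊕ F`. -/
def inl2 : E →L[ℂ] WithLp 2 (E × F) :=
  ((WithLp.prodContinuousLinearEquiv 2 ℂ E F).symm : E × F →L[ℂ] WithLp 2 (E × F)) ∘L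
    .inl ℂ E F

/-- The isometric embedding of the second summand `F` into `E ⊕ F`. -/
def inr2 : F →L[ℂ] WithLp 2 (E × F) :=
  ((WithLp.prodContinuousLinearEquiv 2 ℂ E F).symm : E × F →L[ℂ] WithLp 2 (E × F)) ∘L
    .inr ℂ E F

/-- The orthogonal projection of `E ⊕ F` onto the first summand `E`. -/
def fst2 : WithLp 2 (E × F) →L[ℂ] E :=
  .fst ℂ E F ∘L ((WithLp.prodContinuousLinearEquiv 2 ℂ E F) : WithLp 2 (E × F) →L[ℂ] E × F)

/-- The orthogonal projection of `E ⊕ F` onto the second summand `F`. -/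
def snd2 : WithLp 2 (E × F) →L[ℂ] F :=
  .snd ℂ E F ∘L ((WithLp.prodContinuousLinearEquiv 2 ℂ E F) : WithLp 2 (E × F) →L[ℂ] E × F)

/-- The element `(e, f)` of the orthogonal direct sum `E ⊕ F`. -/
def mk2 (e : E) (f : F) : WithLp 2 (E × F) :=
  (WithLp.prodContinuousLinearEquiv 2 ℂ E F).symm (e, f)


theorem aux_douglas {V W : Type*} [NormedAddCommGroup V] [InnerProductSpace ℂ V] [CompleteSpace V]
    [NormedAddCommGroup W] [InnerProductSpace ℂ W] [CompleteSpace W]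
    (Q : V →L[ℂ] W) (y : V) (c : ℝ) (h : ∀ x, ‖inner ℂ y x‖ ≤ c * ‖Q x‖) :
    ∃ z, adjoint Q z = y := by
  obtain ⟨g, hg⟩ := Q.toLinearMap.rangeRestrict.exists_rightInverse_of_surjective
    (LinearMap.range_rangeRestrict _)
  have hg' : ∀ r, Q (g r) = r := fun r => congrArg Subtype.val (LinearMap.congr_fun hg r)
  let φ : (LinearMap.range Q.toLinearMap) →L[ℂ] ℂ :=
    LinearMap.mkContinuous ((innerSL ℂ y).toLinearMap ∘ₗ g) c (fun r => by
      have := h (g r)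
      rw [hg'] at this
      exact this)
  obtain ⟨ψ, hψ, -⟩ := exists_extension_norm_eq (LinearMap.range Q.toLinearMap) φ
  refine ⟨(InnerProductSpace.toDual ℂ W).symm ψ, ?_⟩
  refine ext_inner_right ℂ fun x => ?_
  rw [adjoint_inner_left, InnerProductSpace.toDual_symm_apply]
  have h1 := hψ ⟨Q x, ⟨x, rfl⟩⟩
  have h2 : φ ⟨Q x, ⟨x, rfl⟩⟩ = inner ℂ y (g ⟨Q x, ⟨x, rfl⟩⟩) := rfl
  rw [h2] at h1
  refine h1.trans ?_
  have h3 := h (g ⟨Q x, ⟨x, rfl⟩⟩ - x)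
  rw [map_sub, hg', sub_self, norm_zero, mul_zero, inner_sub_right] at h3
  exact sub_eq_zero.1 (norm_le_zero_iff.1 h3)

theorem aux_sqrt_norm {V : Type*} [NormedAddCommGroup V] [InnerProductSpace ℂ V] [CompleteSpace V]
    (A : V →L[ℂ] V) (hA : 0 ≤ A) (x : V) :
    ‖CFC.sqrt A x‖ ^ 2 = (inner ℂ x (A x)).re := by
  have hsa : adjoint (CFC.sqrt A) = CFC.sqrt A :=
    (IsSelfAdjoint.of_nonneg (CFC.sqrt_nonneg A))
  have hmul : A x = CFC.sqrt A (CFC.sqrt A x) := by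
    conv_lhs => rw [← CFC.sqrt_mul_sqrt_self A hA]
    rfl
  rw [hmul, ← adjoint_inner_left, hsa, inner_self_eq_norm_sq_to_K]
  norm_cast

theorem aux_sqrt_bound {V : Type*} [NormedAddCommGroup V] [InnerProductSpace ℂ V] [CompleteSpace V]
    (A : V →L[ℂ] V) (y : V) (hy : y ∈ Set.range ⇑(CFC.sqrt A)) :
    ∃ c : ℝ, 0 ≤ c ∧ ∀ x, ‖inner ℂ y x‖ ^ 2 ≤ c * (inner ℂ x (A x)).re := by
  by_cases hA : 0 ≤ A
  · obtain ⟨z, rfl⟩ := hy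
    refine ⟨‖z‖ ^ 2, by positivity, fun x => ?_⟩
    have hsa : adjoint (CFC.sqrt A) = CFC.sqrt A :=
      (IsSelfAdjoint.of_nonneg (CFC.sqrt_nonneg A))
    rw [← aux_sqrt_norm A hA, ← mul_pow, ← adjoint_inner_right, hsa]
    gcongr
    exact norm_inner_le_norm _ _
  · obtain ⟨z, rfl⟩ := hy
    refine ⟨0, le_rfl, fun x => ?_⟩
    have : CFC.sqrt A = 0 := CFC.sqrt_of_not_nonneg hA
    simp [this]

theorem aux_sqrt_mem {V : Type*} [NormedAddCommGroup V] [InnerProductSpace ℂ V] [CompleteSpace V]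
    (A : V →L[ℂ] V) (hA : 0 ≤ A) (y : V) (c : ℝ) (hc : 0 ≤ c)
    (h : ∀ x, ‖inner ℂ y x‖ ^ 2 ≤ c * (inner ℂ x (A x)).re) :
    y ∈ Set.range ⇑(CFC.sqrt A) := by
  have hsa : adjoint (CFC.sqrt A) = CFC.sqrt A :=
    (IsSelfAdjoint.of_nonneg (CFC.sqrt_nonneg A))
  obtain ⟨z, hz⟩ := aux_douglas (CFC.sqrt A) y (√c) (fun x => by
    refine le_of_sq_le_sq ?_ (by positivity)
    rw [mul_pow, Real.sq_sqrt hc, aux_sqrt_norm A hA]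
    exact h x)
  exact ⟨z, by rw [← hz, hsa]⟩

theorem aux_range_mid {K H : Type*} [NormedAddCommGroup K] [InnerProductSpace ℂ K] [CompleteSpace K]
    [NormedAddCommGroup H] [InnerProductSpace ℂ H] [CompleteSpace H]
    (B : H →L[ℂ] K) (M : H →L[ℂ] H) (y : K)
    (hy : y ∈ Set.range ⇑(CFC.sqrt (B ∘L M ∘L adjoint B))) : ∃ h, B h = y := by
  obtain ⟨c, hc, h⟩ := aux_sqrt_bound _ y hy
  have := aux_douglas (adjoint B) y (√(c * ‖M‖)) (fun x => by
    refine le_of_sq_le_sq ?_ (by positivity)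
    rw [mul_pow, Real.sq_sqrt (by positivity), mul_assoc]
    refine (h x).trans ?_
    gcongr
    simp only [ContinuousLinearMap.comp_apply]
    rw [← adjoint_inner_left]
    refine (Complex.re_le_norm _).trans ((norm_inner_le_norm _ _).trans ?_)
    have := M.le_opNorm (adjoint B x)
    nlinarith [norm_nonneg (adjoint B x)])
  simpa using this

theorem aux_inner_blk {K H : Type*} [NormedAddCommGroup K] [InnerProductSpace ℂ K]
    [NormedAddCommGroup H] [InnerProductSpace ℂ H]
    (A : K →L[ℂ] K) (B : H →L[ℂ] K) (C : K →L[ℂ] H) (D : H →L[ℂ] H)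
    (v w : WithLp 2 (K × H)) :
    inner ℂ v (blk A B C D w) =
      inner ℂ v.fst (A w.fst + B w.snd) + inner ℂ v.snd (C w.fst + D w.snd) := rfl

theorem aux_main {K H : Type*} [NormedAddCommGroup K] [InnerProductSpace ℂ K] [CompleteSpace K]
    [NormedAddCommGroup H] [InnerProductSpace ℂ H] [CompleteSpace H]
    (A : K →L[ℂ] K) (B : H →L[ℂ] K) (D : H →L[ℂ] H)
    (hP : 0 ≤ blk A B (adjoint B) D)
    (hran : Set.range ⇑(CFC.sqrt (blk A B (adjoint B) D)) ∩
        Set.range ⇑(inr2 (E := K) (F := H)) = {0})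
    (hD : IsUnit D) (h : H)
    (hy : B h ∈ Set.range ⇑(CFC.sqrt (A - B ∘L Ring.inverse D ∘L adjoint B))) : B h = 0 := by
  set P := blk A B (adjoint B) D with hPdef
  have hPpos := (nonneg_iff_isPositive P).1 hP
  have hDD : D * Ring.inverse D = 1 := Ring.mul_inverse_cancel D hD
  have hDD' : Ring.inverse D * D = 1 := Ring.inverse_mul_cancel D hD
  have hDsym : ∀ f g : H, inner ℂ (D f) g = inner ℂ f (D g) := by
    intro f g
    have := hPpos.isSymmetric (WithLp.toLp 2 ((0 : K), f)) (WithLp.toLp 2 ((0 : K), g))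
    have h1 := aux_inner_blk A B (adjoint B) D (WithLp.toLp 2 ((0 : K), f))
      (WithLp.toLp 2 ((0 : K), g))
    have h2 := aux_inner_blk A B (adjoint B) D (WithLp.toLp 2 ((0 : K), g))
      (WithLp.toLp 2 ((0 : K), f))
    simp only [ContinuousLinearMap.coe_coe] at this
    rw [hPdef, h1, ← inner_conj_symm, h2] at this
    simpa using this
  have hDpos : ∀ f : H, 0 ≤ (inner ℂ f (D f)).re := by
    intro f
    have := hPpos.re_inner_nonneg_right (WithLp.toLp 2 ((0 : K), f))
    rw [hPdef, aux_inner_blk] at this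
    simpa using this
  obtain ⟨c, hc, hb⟩ := aux_sqrt_bound _ _ hy
  have hmem1 : (WithLp.toLp 2 (B h, (0 : H))) ∈ Set.range ⇑(CFC.sqrt P) := by
    refine aux_sqrt_mem P hP _ c hc fun v => ?_
    obtain ⟨k, f⟩ := v
    have e1 : inner ℂ (WithLp.toLp 2 (B h, (0 : H))) (WithLp.toLp 2 (k, f)) = inner ℂ (B h) k := by
      simp [WithLp.prod_inner_apply]
    rw [e1]
    refine (hb k).trans (mul_le_mul_of_nonneg_left ?_ hc)
    rw [hPdef, aux_inner_blk]
    set g := Ring.inverse D (adjoint B k) with hg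
    have hDg : D g = adjoint B k := congrArg (fun T : H →L[ℂ] H => T (adjoint B k)) hDD
    have e2 : (A - B ∘L Ring.inverse D ∘L adjoint B) k = A k - B g := rfl
    rw [e2]
    change _ ≤ (inner ℂ k (A k + B f) + inner ℂ f (adjoint B k + D f)).re
    have e3 : inner ℂ k (A k + B f) + inner ℂ f (adjoint B k + D f)
      = inner ℂ k (A k - B g) + inner ℂ (g + f) (D (g + f)) := by
      rw [inner_add_right, inner_sub_right, ← adjoint_inner_left B f k,
        ← adjoint_inner_left B g k, ← hDg, map_add]
      simp only [inner_add_left, inner_add_right, hDsym]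
      ring
    rw [e3, Complex.add_re]
    linarith [hDpos (g + f)]
  have hmem2 : (WithLp.toLp 2 (B h, D h)) ∈ Set.range ⇑(CFC.sqrt P) := by
    refine ⟨CFC.sqrt P (WithLp.toLp 2 ((0 : K), h)), ?_⟩
    have : CFC.sqrt P (CFC.sqrt P (WithLp.toLp 2 ((0 : K), h)))
        = P (WithLp.toLp 2 ((0 : K), h)) := by
      conv_rhs => rw [← CFC.sqrt_mul_sqrt_self P hP]
      rfl
    rw [this]
    change WithLp.toLp 2 (A 0 + B h, adjoint B 0 + D h) = _
    simp
  obtain ⟨u, hu⟩ := hmem1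
  obtain ⟨v, hv⟩ := hmem2
  have hmem : inr2 (E := K) (D h) ∈ ({0} : Set (WithLp 2 (K × H))) := by
    rw [← hran]
    refine ⟨⟨v - u, ?_⟩, ⟨D h, rfl⟩⟩
    rw [map_sub, hu, hv]
    change WithLp.toLp 2 (B h - B h, D h - 0) = WithLp.toLp 2 ((0 : K), D h)
    simp
  have hDh : D h = 0 := congrArg WithLp.snd (Set.mem_singleton_iff.1 hmem)
  have : h = Ring.inverse D (D h) :=
    (congrArg (fun T : H →L[ℂ] H => T h) hDD').symm
  rw [this, hDh]
  simp

theorem aux_nonneg {V : Type*} [NormedAddCommGroup V] [InnerProductSpace ℂ V] [CompleteSpace V]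
    (X : V →L[ℂ] V) (hX : IsSelfAdjoint X) (hc : ‖X‖ ≤ 1) : 0 ≤ 1 + X := by
  rw [nonneg_iff_isPositive, isPositive_def']
  refine ⟨(IsSelfAdjoint.one _).add hX, fun x => ?_⟩
  rw [reApplyInnerSelf_apply]
  change 0 ≤ (inner ℂ (x + X x) x).re
  rw [inner_add_left, Complex.add_re, inner_self_eq_norm_sq_to_K]
  have h1 : ‖inner ℂ (X x) x‖ ≤ ‖x‖ * ‖x‖ := by
    refine (norm_inner_le_norm _ _).trans ?_
    gcongr
    exact X.le_of_opNorm_le hc x |>.trans (by simp)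
  have h2 := (abs_le.1 (Complex.abs_re_le_norm (inner ℂ (X x) x))).1
  have h3 : ((((‖x‖ : ℝ) : ℂ)) ^ 2).re = ‖x‖ ^ 2 := by norm_cast
  simp only [Complex.coe_algebraMap]
  rw [h3]
  nlinarith

theorem aux_nonneg_sub {V : Type*} [NormedAddCommGroup V] [InnerProductSpace ℂ V]
    [CompleteSpace V]
    (X : V →L[ℂ] V) (hX : IsSelfAdjoint X) (hc : ‖X‖ ≤ 1) : 0 ≤ 1 - X := by
  rw [sub_eq_add_neg]
  exact aux_nonneg _ hX.neg (by rwa [norm_neg])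

/-- If the selfadjoint contraction `X = [[X₁₁, X₁₂], [X₁₂*, X₂₂]]` on `K ⊕ H` satisfies
`ran (I ± X)^{1/2} ∩ ({0} ⊕ H) = {0}` (i.e. `(I ± X)_H = 0`) and `‖X₂₂‖ < 1`, then the
selfadjoint contractions `Ẑ₀ = X₁₁ − X₁₂ (I + X₂₂)⁻¹ X₁₂*` and
`Ẑ₁ = X₁₁ + X₁₂ (I − X₂₂)⁻¹ X₁₂*` satisfy
`ran (Ẑ₁ − Ẑ₀)^{1/2} ∩ ran (I + Ẑ₀)^{1/2} = {0}` and
`ran (Ẑ₁ − Ẑ₀)^{1/2} ∩ ran (I − Ẑ₁)^{1/2} = {0}`. -/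
theorem stmt_9 {K H : Type*} [NormedAddCommGroup K] [InnerProductSpace ℂ K] [CompleteSpace K]
    [NormedAddCommGroup H] [InnerProductSpace ℂ H] [CompleteSpace H]
    (X11 : K →L[ℂ] K) (X12 : H →L[ℂ] K) (X22 : H →L[ℂ] H)
    (hXsa : IsSelfAdjoint (blk X11 X12 (adjoint X12) X22))
    (hXc : ‖blk X11 X12 (adjoint X12) X22‖ ≤ 1)
    (hplus : Set.range ⇑(CFC.sqrt (1 + blk X11 X12 (adjoint X12) X22)) ∩
        Set.range ⇑(inr2 (E := K) (F := H)) = {0})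
    (hminus : Set.range ⇑(CFC.sqrt (1 - blk X11 X12 (adjoint X12) X22)) ∩
        Set.range ⇑(inr2 (E := K) (F := H)) = {0})
    (hX22 : ‖X22‖ < 1) :
    let Z0 := X11 - X12 ∘L Ring.inverse (1 + X22) ∘L adjoint X12
    let Z1 := X11 + X12 ∘L Ring.inverse (1 - X22) ∘L adjoint X12
    Set.range ⇑(CFC.sqrt (Z1 - Z0)) ∩ Set.range ⇑(CFC.sqrt (1 + Z0)) = {0} ∧
      Set.range ⇑(CFC.sqrt (Z1 - Z0)) ∩ Set.range ⇑(CFC.sqrt (1 - Z1)) = {0} := by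
  intro Z0 Z1
  have hpos1 := aux_nonneg _ hXsa hXc
  have hpos2 := aux_nonneg_sub _ hXsa hXc
  have e1 : 1 + blk X11 X12 (adjoint X12) X22
      = blk (1 + X11) X12 (adjoint X12) (1 + X22) := by
    ext1 v
    refine WithLp.ofLp_injective 2 (Prod.ext ?_ ?_)
    · change v.fst + (X11 v.fst + X12 v.snd) = (v.fst + X11 v.fst) + X12 v.snd
      abel
    · change v.snd + (adjoint X12 v.fst + X22 v.snd) = adjoint X12 v.fst + (v.snd + X22 v.snd)
      abel
  have e2 : 1 - blk X11 X12 (adjoint X12) X22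
      = blk (1 - X11) (-X12) (adjoint (-X12)) (1 - X22) := by
    rw [map_neg]
    ext1 v
    refine WithLp.ofLp_injective 2 (Prod.ext ?_ ?_)
    · change v.fst - (X11 v.fst + X12 v.snd) = (v.fst - X11 v.fst) + -X12 v.snd
      abel
    · change v.snd - (adjoint X12 v.fst + X22 v.snd) = -adjoint X12 v.fst + (v.snd - X22 v.snd)
      abel
  rw [e2] at hpos2
  rw [e1] at hpos1 hplus
  rw [e2] at hminus
  have u2 : IsUnit (1 - X22) := isUnit_one_sub_of_norm_lt_one hX22
  have u1 : IsUnit (1 + X22) := by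
    have := isUnit_one_sub_of_norm_lt_one (x := -X22) (by rwa [norm_neg])
    rwa [sub_neg_eq_add] at this
  have eZ : Z1 - Z0 = X12 ∘L (Ring.inverse (1 - X22) + Ring.inverse (1 + X22)) ∘L adjoint X12 := by
    ext x
    simp only [Z0, Z1, sub_apply, add_apply, ContinuousLinearMap.comp_apply, map_add]
    abel
  have z1 : 1 + Z0 = (1 + X11) - X12 ∘L Ring.inverse (1 + X22) ∘L adjoint X12 := by
    simp only [Z0]; abel
  have z2 : 1 - Z1 = (1 - X11) - (-X12) ∘L Ring.inverse (1 - X22) ∘L adjoint (-X12) := by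
    ext x
    simp only [Z1, sub_apply, add_apply, ContinuousLinearMap.comp_apply, map_neg, neg_apply, neg_neg]
    abel
  constructor
  · refine Set.Subset.antisymm ?_ ?_
    · rintro y ⟨hy1, hy2⟩
      rw [eZ] at hy1
      rw [z1] at hy2
      obtain ⟨h, rfl⟩ := aux_range_mid _ _ _ hy1
      exact aux_main _ _ _ hpos1 hplus u1 h hy2
    · rintro y rfl
      exact ⟨⟨0, map_zero _⟩, ⟨0, map_zero _⟩⟩
  · refine Set.Subset.antisymm ?_ ?_
    · rintro y ⟨hy1, hy2⟩
      rw [eZ] at hy1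
      rw [z2] at hy2
      obtain ⟨h, rfl⟩ := aux_range_mid _ _ _ hy1
      have e3 : X12 h = (-X12) (-h) := by simp
      rw [e3] at hy2 ⊢
      exact aux_main _ _ _ hpos2 hminus u2 (-h) hy2
    · rintro y rfl
      exact ⟨⟨0, map_zero _⟩, ⟨0, map_zero _⟩⟩
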